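/- Let G be a finite simple graph containing an edge uv with d(u) + d(v) ≤ 9. Then there exists a set B of at most 8 edges of G such that γ_i(G − B) > γ_i(G); that is, b_i(G) ≤ 8. -/

import Mathlib

open scoped BigOperators

/-- A set of vertices is an independent dominating set: it is independent
(no two of its vertices are adjacent) and dominating (every vertex is in it
or adjacent to a vertex in it). -/
def SimpleGraph.IsIndepDomSet {V : Type*} (G : SimpleGraph V) (S : Set V) : Prop :=
  (∀ u ∈ S, ∀ w ∈ S, ¬ G.Adj u w) ∧ ∀ x, x ∈ S ∨ ∃ u ∈ S, G.Adj u x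

/-- The independent domination number: the minimum cardinality of an
independent dominating set. -/
noncomputable def SimpleGraph.indepDomNum {V : Type*} (G : SimpleGraph V) : ℕ :=
  sInf {n | ∃ S : Set V, G.IsIndepDomSet S ∧ S.ncard = n}

namespace SimpleGraph

variable {V : Type*} {G : SimpleGraph V}

lemma exists_isIndepDomSet [Finite V] (G : SimpleGraph V) : ∃ S : Set V, G.IsIndepDomSet S := by
  obtain ⟨S, hS⟩ := Set.Finite.exists_maximal (Set.toFinite {S : Set V | G.IsIndepSet S})
    ⟨∅, by simp⟩
  refine ⟨S, fun a ha b hb hab => hS.prop ha hb hab.ne hab, fun x => ?_⟩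
  by_contra! hx
  refine hx.1 (hS.le_of_ge (y := insert x S) ?_ (Set.subset_insert x S) (Set.mem_insert x S))
  exact hS.prop.insert fun b hb _ => ⟨fun h => hx.2 b hb h.symm, hx.2 b hb⟩

lemma exists_isIndepDomSet_ncard_eq [Finite V] (G : SimpleGraph V) :
    ∃ S : Set V, G.IsIndepDomSet S ∧ S.ncard = G.indepDomNum :=
  let ⟨S, hS⟩ := G.exists_isIndepDomSet
  Nat.sInf_mem (s := {n | ∃ S : Set V, G.IsIndepDomSet S ∧ S.ncard = n}) ⟨_, S, hS, rfl⟩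

lemma IsIndepDomSet.indepDomNum_le {S : Set V} (hS : G.IsIndepDomSet S) :
    G.indepDomNum ≤ S.ncard :=
  Nat.sInf_le ⟨S, hS, rfl⟩

/-- An independent dominating set of the graph obtained by isolating two adjacent vertices `u`, `v`
properly contains an independent dominating set of the original graph. -/
lemma IsIndepDomSet.exists_ssubset {u v : V} (huv : G.Adj u v) {S : Set V}
    (hS : (G.deleteEdges (G.incidenceSet u ∪ G.incidenceSet v)).IsIndepDomSet S) :
    ∃ T ⊂ S, G.IsIndepDomSet T := by
  have adj_iff (a b : V) : (G.deleteEdges (G.incidenceSet u ∪ G.incidenceSet v)).Adj a b ↔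
      G.Adj a b ∧ a ≠ u ∧ a ≠ v ∧ b ≠ u ∧ b ≠ v := by
    simp only [deleteEdges_adj, Set.mem_union, incidenceSet, Set.mem_ofPred_eq, mem_edgeSet,
      Sym2.mem_iff]
    grind
  obtain ⟨hind, hdom⟩ := hS
  simp only [adj_iff] at hind hdom
  have huS : u ∈ S := by grind
  have hvS : v ∈ S := by grind
  have huv' := huv.symm
  have hne := huv.ne
  have hsymm (a b : V) (h : G.Adj a b) : G.Adj b a := h.symm
  have hirr (a : V) : ¬ G.Adj a a := G.irrefl
  by_cases hu : ∃ a ∈ S \ {u, v}, G.Adj a u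
  · by_cases hv : ∃ a ∈ S \ {u, v}, G.Adj a v
    · refine ⟨S \ {u, v}, ⟨Set.sdiff_subset, fun h => (h huS).2 (by simp)⟩, ?_, ?_⟩ <;> grind
    · refine ⟨S \ {u}, ⟨Set.sdiff_subset, fun h => (h huS).2 rfl⟩, ?_, ?_⟩ <;> grind
  · refine ⟨S \ {v}, ⟨Set.sdiff_subset, fun h => (h hvS).2 rfl⟩, ?_, ?_⟩ <;> grind

lemma indepDomNum_lt_deleteEdges_incidenceSet [Finite V] {u v : V} (huv : G.Adj u v) :
    G.indepDomNum <
      (G.deleteEdges (G.incidenceSet u ∪ G.incidenceSet v)).indepDomNum := by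
  obtain ⟨S, hS, hcard⟩ := exists_isIndepDomSet_ncard_eq
    (G.deleteEdges (G.incidenceSet u ∪ G.incidenceSet v))
  obtain ⟨T, hTS, hT⟩ := hS.exists_ssubset huv
  exact hcard ▸ hT.indepDomNum_le.trans_lt (Set.ncard_lt_ncard hTS)

lemma ncard_incidenceSet (G : SimpleGraph V) (v : V) :
    (G.incidenceSet v).ncard = (G.neighborSet v).ncard := by
  classical
  exact Nat.card_congr (G.incidenceSetEquivNeighborSet v)

lemma ncard_incidenceSet_union_add_one [Finite V] {u v : V} (huv : G.Adj u v) :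
    (G.incidenceSet u ∪ G.incidenceSet v).ncard + 1 =
      (G.neighborSet u).ncard + (G.neighborSet v).ncard := by
  have h := Set.ncard_union_add_ncard_inter (G.incidenceSet u) (G.incidenceSet v)
  rwa [G.incidenceSet_inter_incidenceSet_of_adj huv, Set.ncard_singleton, ncard_incidenceSet,
    ncard_incidenceSet] at h

end SimpleGraph

theorem stmt15 {V : Type*} [Fintype V]
    (G : SimpleGraph V) (u v : V) (huv : G.Adj u v)
    (hdeg : (G.neighborSet u).ncard + (G.neighborSet v).ncard ≤ 9) :
    ∃ B : Finset (Sym2 V), ↑B ⊆ G.edgeSet ∧ B.card ≤ 8 ∧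
      G.indepDomNum < (G.deleteEdges ↑B).indepDomNum := by
  have hfin : (G.incidenceSet u ∪ G.incidenceSet v).Finite := Set.toFinite _
  refine ⟨hfin.toFinset, ?_, ?_, ?_⟩
  · rw [hfin.coe_toFinset]
    exact Set.union_subset (G.incidenceSet_subset u) (G.incidenceSet_subset v)
  · rw [← Set.ncard_eq_toFinset_card _ hfin]
    have := SimpleGraph.ncard_incidenceSet_union_add_one huv
    omega
  · rw [hfin.coe_toFinset]
    exact SimpleGraph.indepDomNum_lt_deleteEdges_incidenceSet huv
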